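/- Let C be a commutative ℚ-algebra and λ ∈ C. In the polynomial algebra C[x], let p_n(x) = x(x−λ)(x−2λ)⋯(x−(n−1)λ)/n! for n ≥ 0 (a C-basis of C[x]). Then there is a Hopf C-algebra structure on C[x] whose multiplication and unit are the usual ones, whose comultiplication Δ is the C-linear map determined by Δ(p_n) = Σ_{k=0}^{n} Σ_{i=0}^{n−k} (−λ)ᵏ · p_i ⊗ p_{n−k−i}, and whose counit ε is the C-linear map determined by ε(p_0) = 1, ε(p_1) = λ, and ε(p_n) = 0 for n ≥ 2; that is, with these structure maps C[x] is a bialgebra admitting an antipode. (This is the Hopf algebra structure on the free Baxter algebra Ш_C(C,λ) transported along the isomorphism 1^{⊗(n+1)} ↦ p_n.) -/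

import Mathlib

open TensorProduct

/-- `p_n(x) = x(x−λ)(x−2λ)⋯(x−(n−1)λ)/n!` in `C[x]`, for `C` a commutative
`ℚ`-algebra and `λ ∈ C` — a `C`-basis of `C[x]`, realizing the free Baxter algebra
`Ш_C(C,λ)` via `1^{⊗(n+1)} ↦ p_n`. -/
noncomputable def mixablePoly {C : Type*} [CommRing C] [Algebra ℚ C] (lam : C)
    (n : ℕ) : Polynomial C :=
  ((n.factorial : ℚ)⁻¹) • ∏ i ∈ Finset.range n, (Polynomial.X - Polynomial.C ((i : C) * lam))

namespace mixablePoly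

open Polynomial

variable {C A : Type*} [CommRing C] [CommRing A] [Algebra C A]

/-- The comultiplication `x ↦ x ⊗ 1 + 1 ⊗ x - λ`. -/
noncomputable def comul (lam : C) : C[X] →ₐ[C] C[X] ⊗[C] C[X] :=
  aeval (X ⊗ₜ[C] 1 + 1 ⊗ₜ[C] X - algebraMap C (C[X] ⊗[C] C[X]) lam)

/-- The counit, evaluation at `λ`. -/
noncomputable def counit (lam : C) : C[X] →ₐ[C] C :=
  aeval lam

/-- The antipode `x ↦ 2λ - x`. -/
noncomputable def antipode (lam : C) : C[X] →ₐ[C] C[X] :=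
  aeval (2 * algebraMap C C[X] lam - X)

theorem comul_coassoc (lam : C) :
    (Algebra.TensorProduct.assoc C C C C[X] C[X] C[X]).toAlgHom.comp
      ((Algebra.TensorProduct.map (comul lam) (AlgHom.id C C[X])).comp (comul lam)) =
    (Algebra.TensorProduct.map (AlgHom.id C C[X]) (comul lam)).comp (comul lam) := by
  ext
  simp [comul, Algebra.TensorProduct.one_def, Algebra.algebraMap_eq_smul_one,
    add_tmul, tmul_add, sub_tmul, tmul_sub, ← TensorProduct.smul_tmul']
  abel

theorem counit_comul_left (lam : C) :
    (Algebra.TensorProduct.lid C C[X]).toAlgHom.comp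
      ((Algebra.TensorProduct.map (counit lam) (AlgHom.id C C[X])).comp (comul lam)) =
    AlgHom.id C C[X] := by
  ext
  simp [comul, counit, Algebra.smul_def]

theorem counit_comul_right (lam : C) :
    (Algebra.TensorProduct.rid C C C[X]).toAlgHom.comp
      ((Algebra.TensorProduct.map (AlgHom.id C C[X]) (counit lam)).comp (comul lam)) =
    AlgHom.id C C[X] := by
  ext
  simp [comul, counit, Algebra.smul_def]

theorem antipode_comul_left (lam : C) :
    (Algebra.TensorProduct.lmul' C (S := C[X])).comp
      ((Algebra.TensorProduct.map (antipode lam) (AlgHom.id C C[X])).comp (comul lam)) =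
    (Algebra.ofId C C[X]).comp (counit lam) := by
  refine algHom_ext ?_
  simp [comul, counit, antipode, Algebra.ofId_apply]
  ring

theorem antipode_comul_right (lam : C) :
    (Algebra.TensorProduct.lmul' C (S := C[X])).comp
      ((Algebra.TensorProduct.map (AlgHom.id C C[X]) (antipode lam)).comp (comul lam)) =
    (Algebra.ofId C C[X]).comp (counit lam) := by
  refine algHom_ext ?_
  simp [comul, counit, antipode, Algebra.ofId_apply]
  ring

variable [Algebra ℚ C]

theorem zero (lam : C) : mixablePoly lam 0 = 1 := by
  simp [mixablePoly]

theorem succ_mul_succ (lam : C) (n : ℕ) :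
    ((n + 1 : ℕ) : C[X]) * mixablePoly lam (n + 1) =
      (X - Polynomial.C (n * lam)) * mixablePoly lam n := by
  have h : ((n + 1 : ℕ) : ℚ) * (((n + 1).factorial : ℚ)⁻¹) = (n.factorial : ℚ)⁻¹ := by
    rw [Nat.factorial_succ]
    push_cast
    field_simp
  rw [mixablePoly, mixablePoly, Finset.prod_range_succ, ← nsmul_eq_mul,
    ← Nat.cast_smul_eq_nsmul ℚ, smul_smul, h, mul_comm (X - _), smul_mul_assoc]

theorem one (lam : C) : mixablePoly lam 1 = X := by
  simpa [zero] using succ_mul_succ lam 0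

theorem succ_mul_aeval_succ (lam : C) (z : A) (n : ℕ) :
    ((n : A) + 1) * aeval z (mixablePoly lam (n + 1)) =
      (z - n * algebraMap C A lam) * aeval z (mixablePoly lam n) := by
  simpa using congrArg (aeval z) (succ_mul_succ lam n)

theorem isUnit_natCast_succ (C : Type*) {A : Type*} [CommRing C] [Algebra ℚ C] [CommRing A]
    [Algebra C A] (n : ℕ) : IsUnit ((n : A) + 1) := by
  have h : IsUnit ((n : ℚ) + 1) := by
    rw [isUnit_iff_ne_zero]
    positivity
  simpa using h.map ((algebraMap C A).comp (algebraMap ℚ C))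

theorem aeval_add (lam : C) (x y : A) (n : ℕ) :
    aeval (x + y) (mixablePoly lam n) =
      ∑ ij ∈ Finset.HasAntidiagonal.antidiagonal n,
        aeval x (mixablePoly lam ij.1) * aeval y (mixablePoly lam ij.2) := by
  induction n with
  | zero => simp [zero]
  | succ n ih =>
    refine (isUnit_natCast_succ (A := A) C n).mul_left_cancel ?_
    have h₁ := Finset.Nat.sum_antidiagonal_succ (n := n) (f := fun ij : ℕ × ℕ =>
      (ij.1 : A) * (aeval x (mixablePoly lam ij.1) * aeval y (mixablePoly lam ij.2)))
    have h₂ := Finset.Nat.sum_antidiagonal_succ' (n := n) (f := fun ij : ℕ × ℕ =>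
      (ij.2 : A) * (aeval x (mixablePoly lam ij.1) * aeval y (mixablePoly lam ij.2)))
    simp only [Nat.cast_zero, zero_mul, zero_add, Nat.cast_add, Nat.cast_one] at h₁ h₂
    have h : ((n : A) + 1) * ∑ ij ∈ Finset.HasAntidiagonal.antidiagonal (n + 1),
        aeval x (mixablePoly lam ij.1) * aeval y (mixablePoly lam ij.2) =
        (∑ ij ∈ Finset.HasAntidiagonal.antidiagonal (n + 1),
          (ij.1 : A) * (aeval x (mixablePoly lam ij.1) * aeval y (mixablePoly lam ij.2))) +
        ∑ ij ∈ Finset.HasAntidiagonal.antidiagonal (n + 1),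
          (ij.2 : A) * (aeval x (mixablePoly lam ij.1) * aeval y (mixablePoly lam ij.2)) := by
      rw [Finset.mul_sum, ← Finset.sum_add_distrib]
      refine Finset.sum_congr rfl fun ij hij => ?_
      have hc : (ij.1 : A) + ij.2 = n + 1 := by
        exact_mod_cast congrArg (Nat.cast (R := A)) (Finset.HasAntidiagonal.mem_antidiagonal.mp hij)
      rw [← hc, add_mul]
    rw [h, h₁, h₂, succ_mul_aeval_succ, ih, Finset.mul_sum, ← Finset.sum_add_distrib]
    refine Finset.sum_congr rfl fun ij hij => ?_
    have hc : (ij.1 : A) + ij.2 = n := by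
      exact_mod_cast congrArg (Nat.cast (R := A)) (Finset.HasAntidiagonal.mem_antidiagonal.mp hij)
    rw [← hc]
    linear_combination
      -aeval y (mixablePoly lam ij.2) * succ_mul_aeval_succ lam x ij.1 -
        aeval x (mixablePoly lam ij.1) * succ_mul_aeval_succ lam y ij.2

theorem mul_aeval_sub (lam : C) (z : A) (n : ℕ) :
    z * aeval (z - algebraMap C A lam) (mixablePoly lam n) =
      (z - n * algebraMap C A lam) * aeval z (mixablePoly lam n) := by
  induction n with
  | zero => simp [zero]
  | succ n ih =>
    refine (isUnit_natCast_succ (A := A) C n).mul_left_cancel ?_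
    have h₁ := succ_mul_aeval_succ lam z n
    have h₂ := succ_mul_aeval_succ lam (z - algebraMap C A lam) n
    push_cast
    linear_combination z * h₂ - (z - (n + 1) * algebraMap C A lam) * h₁ +
      (z - (n + 1) * algebraMap C A lam) * ih

theorem aeval_sub_succ (lam : C) (z : A) (n : ℕ) :
    aeval (z - algebraMap C A lam) (mixablePoly lam (n + 1)) =
      aeval z (mixablePoly lam (n + 1)) -
        algebraMap C A lam * aeval (z - algebraMap C A lam) (mixablePoly lam n) := by
  refine (isUnit_natCast_succ (A := A) C n).mul_left_cancel ?_
  linear_combination succ_mul_aeval_succ lam (z - algebraMap C A lam) n -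
    succ_mul_aeval_succ lam z n + mul_aeval_sub lam z n

theorem aeval_sub (lam : C) (z : A) (n : ℕ) :
    aeval (z - algebraMap C A lam) (mixablePoly lam n) =
      ∑ k ∈ Finset.range (n + 1), (-lam) ^ k • aeval z (mixablePoly lam (n - k)) := by
  induction n with
  | zero => simp [zero]
  | succ n ih =>
    rw [Finset.sum_range_succ', aeval_sub_succ, ih, Finset.mul_sum, sub_eq_add_neg, add_comm,
      ← Finset.sum_neg_distrib]
    congr 1
    · refine Finset.sum_congr rfl fun k _ => ?_
      simp only [Nat.add_sub_add_right, Algebra.smul_def, map_pow, map_neg, map_mul, pow_succ]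
      ring
    · simp

theorem aeval_self_eq_zero (lam : C) (n : ℕ) :
    aeval lam (mixablePoly lam (n + 2)) = 0 := by
  refine (isUnit_natCast_succ (A := C) C (n + 1)).mul_left_cancel ?_
  rw [succ_mul_aeval_succ, mul_zero]
  induction n with
  | zero => simp
  | succ n ih =>
    have h : aeval lam (mixablePoly lam (n + 1 + 1)) = 0 := by
      refine (isUnit_natCast_succ (A := C) C (n + 1)).mul_left_cancel ?_
      rw [succ_mul_aeval_succ, mul_zero, ih]
    rw [h, mul_zero]

theorem comul_apply (lam : C) (n : ℕ) :
    comul lam (mixablePoly lam n) =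
      ∑ k ∈ Finset.range (n + 1), ∑ i ∈ Finset.range (n - k + 1),
        (-lam) ^ k • (mixablePoly lam i ⊗ₜ[C] mixablePoly lam (n - k - i)) := by
  have hl (p : C[X]) : aeval (X ⊗ₜ[C] (1 : C[X])) p = p ⊗ₜ[C] (1 : C[X]) := by
    simpa using aeval_algHom_apply
      (Algebra.TensorProduct.includeLeft : C[X] →ₐ[C] C[X] ⊗[C] C[X]) X p
  have hr (p : C[X]) : aeval ((1 : C[X]) ⊗ₜ[C] X) p = (1 : C[X]) ⊗ₜ[C] p := by
    simpa using aeval_algHom_apply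
      (Algebra.TensorProduct.includeRight : C[X] →ₐ[C] C[X] ⊗[C] C[X]) X p
  rw [comul, aeval_sub]
  refine Finset.sum_congr rfl fun k _ => ?_
  rw [aeval_add, Finset.Nat.sum_antidiagonal_eq_sum_range_succ_mk, Finset.smul_sum]
  simp [hl, hr]

end mixablePoly

/-- There is a Hopf `C`-algebra structure on `C[x]` with the usual multiplication
and unit, whose comultiplication `Δ` is the `C`-linear map determined by
`Δ(p_n) = Σ_{k=0}^{n} Σ_{i=0}^{n−k} (−λ)ᵏ · p_i ⊗ p_{n−k−i}` and whose counit `ε`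
is determined by `ε(p_0) = 1`, `ε(p_1) = λ`, `ε(p_n) = 0` for `n ≥ 2`: with these
structure maps `C[x]` is a bialgebra admitting an antipode `S`. -/
theorem mixable_free_baxter_hopf {C : Type*} [CommRing C] [Algebra ℚ C] (lam : C) :
    ∃ (Δ : Polynomial C →ₗ[C] Polynomial C ⊗[C] Polynomial C)
      (ε : Polynomial C →ₗ[C] C) (S : Polynomial C →ₗ[C] Polynomial C),
      -- the prescribed values of the comultiplication on the basis (p_n)
      (∀ n : ℕ, Δ (mixablePoly lam n) =
          ∑ k ∈ Finset.range (n + 1), ∑ i ∈ Finset.range (n - k + 1),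
            (-lam) ^ k • (mixablePoly lam i ⊗ₜ[C] mixablePoly lam (n - k - i))) ∧
      -- the prescribed values of the counit on the basis (p_n)
      (ε (mixablePoly lam 0) = 1) ∧
      (ε (mixablePoly lam 1) = lam) ∧
      (∀ n : ℕ, 2 ≤ n → ε (mixablePoly lam n) = 0) ∧
      -- coassociativity of Δ
      (∀ a : Polynomial C,
          (TensorProduct.assoc C (Polynomial C) (Polynomial C) (Polynomial C))
              (TensorProduct.map Δ LinearMap.id (Δ a)) =
            TensorProduct.map LinearMap.id Δ (Δ a)) ∧
      -- counit axioms
      (∀ a : Polynomial C,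
          (TensorProduct.lid C (Polynomial C)) (TensorProduct.map ε LinearMap.id (Δ a)) = a) ∧
      (∀ a : Polynomial C,
          (TensorProduct.rid C (Polynomial C)) (TensorProduct.map LinearMap.id ε (Δ a)) = a) ∧
      -- Δ and ε are morphisms of algebras (bialgebra compatibility with the usual
      -- multiplication and unit of C[x])
      (Δ 1 = 1) ∧
      (∀ a b : Polynomial C, Δ (a * b) = Δ a * Δ b) ∧
      (ε 1 = 1) ∧
      (∀ a b : Polynomial C, ε (a * b) = ε a * ε b) ∧
      -- S is an antipode: μ∘(S⊗id)∘Δ = η∘ε = μ∘(id⊗S)∘Δ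
      (∀ a : Polynomial C,
          LinearMap.mul' C (Polynomial C) (TensorProduct.map S LinearMap.id (Δ a)) =
            algebraMap C (Polynomial C) (ε a)) ∧
      (∀ a : Polynomial C,
          LinearMap.mul' C (Polynomial C) (TensorProduct.map LinearMap.id S (Δ a)) =
            algebraMap C (Polynomial C) (ε a)) := by
  refine ⟨(mixablePoly.comul lam).toLinearMap, (mixablePoly.counit lam).toLinearMap,
    (mixablePoly.antipode lam).toLinearMap, mixablePoly.comul_apply lam, ?_, ?_, ?_,
    fun a => DFunLike.congr_fun (mixablePoly.comul_coassoc lam) a,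
    fun a => DFunLike.congr_fun (mixablePoly.counit_comul_left lam) a,
    fun a => DFunLike.congr_fun (mixablePoly.counit_comul_right lam) a,
    map_one (mixablePoly.comul lam), map_mul (mixablePoly.comul lam),
    map_one (mixablePoly.counit lam), map_mul (mixablePoly.counit lam),
    fun a => DFunLike.congr_fun (mixablePoly.antipode_comul_left lam) a,
    fun a => DFunLike.congr_fun (mixablePoly.antipode_comul_right lam) a⟩
  · simp [mixablePoly.zero]
  · simp [mixablePoly.one, mixablePoly.counit]
  · intro n hn
    obtain ⟨m, rfl⟩ := Nat.exists_eq_add_of_le' hn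
    exact mixablePoly.aeval_self_eq_zero lam m
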